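/- The Δ-side length polyhedron for triangles with root system B₂ = C₂, realized by 5×5 real skew-symmetric matrices: For i ∈ {1,2,3} let (xᵢ, yᵢ) ∈ ℝ² satisfy xᵢ ≥ yᵢ ≥ 0. Then there exist real skew-symmetric 5×5 matrices S₁, S₂, S₃ with S₁ + S₂ + S₃ = 0 such that for each i the multiset of eigenvalues of the Hermitian matrix i·Sᵢ is {xᵢ, yᵢ, 0, −yᵢ, −xᵢ}, if and only if for every permutation (i, j, k) of (1, 2, 3) the following hold: (1) xᵢ ≤ xⱼ + x_k; (2) yᵢ − yⱼ ≤ x_k; (3) xᵢ + yᵢ ≤ xⱼ + yⱼ + x_k + y_k; (4) xᵢ − yᵢ − xⱼ + yⱼ ≤ x_k + y_k. Moreover this system of inequalities is irredundant. -/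

import Mathlib

open Matrix

/-- The triple `(x, y)` of points of the Euclidean Weyl chamber of `B₂` is
realized as the spectral data of real skew-symmetric `5×5` matrices
`S₁, S₂, S₃` summing to zero: the Hermitian matrix `i·Sᵢ` has eigenvalue
multiset `{xᵢ, yᵢ, 0, -yᵢ, -xᵢ}`. -/
def SkewB2Realization (x y : Fin 3 → ℝ) : Prop :=
  ∃ S : Fin 3 → Matrix (Fin 5) (Fin 5) ℝ,
    (∀ i, (S i)ᵀ = -(S i)) ∧ (∑ i, S i) = 0 ∧
    ∀ i, ∃ h : (Complex.I • (S i).map (Complex.ofReal ·)).IsHermitian,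
      ∃ τ : Equiv.Perm (Fin 5),
        ∀ j, h.eigenvalues (τ j) = ![x i, y i, 0, -(y i), -(x i)] j

/-- The membership `(x, y) ∈ Δ³` in the cube of the Euclidean Weyl chamber of
`B₂`: `xᵢ ≥ yᵢ ≥ 0`. -/
def B2Chamber (x y : Fin 3 → ℝ) : Prop := ∀ i, y i ≤ x i ∧ 0 ≤ y i

/-- The stability inequalities for triangles and the root system `B₂ = C₂`,
written as the family of linear functionals, indexed by the permutations
`(i,j,k)` of `(1,2,3)`, whose nonpositivity expresses
(1) `xᵢ ≤ xⱼ + xₖ`; (2) `yᵢ - yⱼ ≤ xₖ`;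
(3) `xᵢ + yᵢ ≤ xⱼ + yⱼ + xₖ + yₖ`; (4) `xᵢ - yᵢ - xⱼ + yⱼ ≤ xₖ + yₖ`. -/
def B2Ineqs : Set ((Fin 3 → ℝ) × (Fin 3 → ℝ) → ℝ) :=
  ⋃ σ : Equiv.Perm (Fin 3),
    ({fun p => p.1 (σ 0) - p.1 (σ 1) - p.1 (σ 2),
      fun p => p.2 (σ 0) - p.2 (σ 1) - p.1 (σ 2),
      fun p => (p.1 (σ 0) + p.2 (σ 0)) - (p.1 (σ 1) + p.2 (σ 1)) - (p.1 (σ 2) + p.2 (σ 2)),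
      fun p => (p.1 (σ 0) - p.2 (σ 0)) - (p.1 (σ 1) - p.2 (σ 1)) - (p.1 (σ 2) + p.2 (σ 2))} :
      Set ((Fin 3 → ℝ) × (Fin 3 → ℝ) → ℝ))

section Weyl

variable {E : Type*} [NormedAddCommGroup E] [InnerProductSpace ℂ E] {n : ℕ}

/-- `b` is an orthonormal eigenbasis of `T` with real eigenvalues `e`. -/
def IsEigenbasis (T : E →ₗ[ℂ] E) (b : OrthonormalBasis (Fin n) ℂ E) (e : Fin n → ℝ) : Prop :=
  ∀ i, T (b i) = (e i : ℂ) • b i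

namespace IsEigenbasis

variable {T T' : E →ₗ[ℂ] E} {b b' : OrthonormalBasis (Fin n) ℂ E} {e e' : Fin n → ℝ}

lemma inner_apply (h : IsEigenbasis T b e) (i : Fin n) (v : E) :
    inner ℂ (b i) (T v) = e i * inner ℂ (b i) v := by
  conv_lhs => rw [← b.sum_repr' v]
  simp only [map_sum, map_smul, h _, inner_sum, inner_smul_right, b.inner_eq_ite]
  simp [mul_comm]

lemma inner_self_apply (h : IsEigenbasis T b e) (v : E) :
    RCLike.re (inner ℂ v (T v)) = ∑ i, e i * ‖inner ℂ (b i) v‖ ^ 2 := by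
  rw [← b.sum_inner_mul_inner v (T v), map_sum]
  refine Finset.sum_congr rfl fun i _ => ?_
  rw [h.inner_apply, ← inner_conj_symm v (b i), mul_left_comm, RCLike.conj_mul]
  norm_cast
  exact Complex.re_ofReal_mul _ _

lemma isSymmetric (h : IsEigenbasis T b e) : T.IsSymmetric := by
  intro v w
  rw [← b.sum_inner_mul_inner v (T w), ← b.sum_inner_mul_inner (T v) w]
  refine Finset.sum_congr rfl fun i _ => ?_
  rw [h.inner_apply, ← inner_conj_symm (T v), h.inner_apply, map_mul, inner_conj_symm]
  simp
  ring

lemma trace_eq (h : IsEigenbasis T b e) : LinearMap.trace ℂ E T = ∑ i, (e i : ℂ) := by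
  rw [LinearMap.trace_eq_sum_inner T b]
  refine Finset.sum_congr rfl fun i _ => ?_
  rw [h.inner_apply, b.inner_eq_one, mul_one]

/-- **Weyl monotonicity**: sorted eigenvalues are monotone in the quadratic form. -/
lemma le_of_forall_inner_le (h : IsEigenbasis T b e) (h' : IsEigenbasis T' b' e')
    (he : Antitone e) (he' : Antitone e')
    (hle : ∀ v, RCLike.re (inner ℂ v (T v)) ≤ RCLike.re (inner ℂ v (T' v))) (j : Fin n) :
    e j ≤ e' j := by
  let L : E →ₗ[ℂ] (Fin n → ℂ) := LinearMap.pi fun i =>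
    if i < j then (innerSL ℂ (b' i)).toLinearMap
    else if j < i then (innerSL ℂ (b i)).toLinearMap else 0
  have hL : ¬ Function.Injective L := by
    have : FiniteDimensional ℂ E := b.toBasis.finiteDimensional_of_finite
    rw [LinearMap.injective_iff_surjective_of_finrank_eq_finrank
      (by simp [Module.finrank_eq_card_basis b.toBasis])]
    intro hs
    obtain ⟨v, hv⟩ := hs (Pi.single j 1)
    simpa [L] using congrFun hv j
  obtain ⟨v, hv, hv0⟩ : ∃ v, L v = 0 ∧ v ≠ 0 := by
    simpa [injective_iff_map_eq_zero] using hL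
  have hb' : ∀ i, i < j → inner ℂ (b' i) v = 0 := fun i hi => by
    simpa [L, hi] using congrFun hv i
  have hb : ∀ i, j < i → inner ℂ (b i) v = 0 := fun i hi => by
    simpa [L, hi, hi.not_gt] using congrFun hv i
  have h1 : e j * ‖v‖ ^ 2 ≤ RCLike.re (inner ℂ v (T v)) := by
    rw [h.inner_self_apply, ← b.sum_sq_norm_inner_right v, Finset.mul_sum]
    refine Finset.sum_le_sum fun i _ => ?_
    rcases le_or_gt i j with hi | hi
    · exact mul_le_mul_of_nonneg_right (he hi) (sq_nonneg _)
    · simp [hb i hi]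
  have h2 : RCLike.re (inner ℂ v (T' v)) ≤ e' j * ‖v‖ ^ 2 := by
    rw [h'.inner_self_apply, ← b'.sum_sq_norm_inner_right v, Finset.mul_sum]
    refine Finset.sum_le_sum fun i _ => ?_
    rcases le_or_gt j i with hi | hi
    · exact mul_le_mul_of_nonneg_right (he' hi) (sq_nonneg _)
    · simp [hb' i hi]
  exact le_of_mul_le_mul_right ((h1.trans (hle v)).trans h2) (by positivity)

lemma exists_isEigenbasis_antitone [FiniteDimensional ℂ E] (hT : T.IsSymmetric)
    (hn : Module.finrank ℂ E = n) :
    ∃ (c : OrthonormalBasis (Fin n) ℂ E) (f : Fin n → ℝ), IsEigenbasis T c f ∧ Antitone f :=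
  ⟨hT.eigenvectorBasis hn, hT.eigenvalues hn, hT.apply_eigenvectorBasis hn,
    hT.eigenvalues_antitone hn⟩

/-- **Weyl's inequality** `λⱼ(T + T') ≤ λⱼ(T) + c` when all eigenvalues of `T'` are at most `c`. -/
lemma add_le {b'' : OrthonormalBasis (Fin n) ℂ E} {e'' : Fin n → ℝ} (h : IsEigenbasis T b e)
    (h' : IsEigenbasis T' b' e') (h'' : IsEigenbasis (T + T') b'' e'') (he : Antitone e)
    (he'' : Antitone e'') {c : ℝ} (hc : ∀ i, e' i ≤ c) (j : Fin n) : e'' j ≤ e j + c := by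
  have hT : IsEigenbasis (T + (c : ℂ) • LinearMap.id) b (fun i => e i + c) := fun i => by
    simp [h i, add_smul]
  refine h''.le_of_forall_inner_le hT he'' (fun i k hik => by simpa using he hik) (fun v => ?_) j
  have : RCLike.re (inner ℂ v (T' v)) ≤ c * ‖v‖ ^ 2 := by
    rw [h'.inner_self_apply, ← b'.sum_sq_norm_inner_right v, Finset.mul_sum]
    exact Finset.sum_le_sum fun i _ => mul_le_mul_of_nonneg_right (hc i) (sq_nonneg _)
  have hcv : RCLike.re (inner ℂ v ((c : ℂ) • v)) = c * ‖v‖ ^ 2 := by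
    rw [inner_smul_right, inner_self_eq_norm_sq_to_K]
    norm_cast
    exact Complex.re_ofReal_mul _ _
  simp only [LinearMap.add_apply, LinearMap.smul_apply, LinearMap.id_apply, inner_add_right,
    map_add, hcv]
  linarith

/-- **Lidskii–Wielandt inequality**, in terms of the positive part of `T'`. -/
lemma sum_add_le {b'' : OrthonormalBasis (Fin n) ℂ E} {e'' : Fin n → ℝ} (h : IsEigenbasis T b e)
    (h' : IsEigenbasis T' b' e') (h'' : IsEigenbasis (T + T') b'' e'') (he : Antitone e)
    (he'' : Antitone e'') (J : Finset (Fin n)) :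
    ∑ j ∈ J, e'' j ≤ ∑ j ∈ J, e j + ∑ i, max (e' i) 0 := by
  have : FiniteDimensional ℂ E := b.toBasis.finiteDimensional_of_finite
  set g : Fin n → ℝ := fun i => max (e' i) 0
  let B : E →ₗ[ℂ] E := b'.toBasis.constr ℂ fun i => (g i : ℂ) • b' i
  have hB : IsEigenbasis B b' g := fun i => by
    rw [← b'.coe_toBasis]
    exact (b'.toBasis.constr_basis ℂ _ i).trans (by simp)
  obtain ⟨c, f, hf, hfa⟩ := exists_isEigenbasis_antitone (h.isSymmetric.add hB.isSymmetric)
    (by simp [Module.finrank_eq_card_basis b.toBasis] : Module.finrank ℂ E = n)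
  have hle : ∀ j, e j ≤ f j := h.le_of_forall_inner_le hf he hfa fun v => by
    have : 0 ≤ RCLike.re (inner ℂ v (B v)) := by
      rw [hB.inner_self_apply]
      exact Finset.sum_nonneg fun i _ => mul_nonneg (le_max_right _ _) (sq_nonneg _)
    simp only [LinearMap.add_apply, inner_add_right, map_add]
    linarith
  have hle'' : ∀ j, e'' j ≤ f j := h''.le_of_forall_inner_le hf he'' hfa fun v => by
    have : RCLike.re (inner ℂ v (T' v)) ≤ RCLike.re (inner ℂ v (B v)) := by
      rw [hB.inner_self_apply, h'.inner_self_apply]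
      exact Finset.sum_le_sum fun i _ =>
        mul_le_mul_of_nonneg_right (le_max_left _ _) (sq_nonneg _)
    simp only [LinearMap.add_apply, inner_add_right, map_add]
    linarith
  have htr : ∑ i, f i = ∑ i, e i + ∑ i, g i := by
    have := hf.trace_eq
    rw [map_add, h.trace_eq, hB.trace_eq] at this
    exact_mod_cast this.symm
  have hJ : ∑ j ∈ J, (f j - e j) ≤ ∑ j, (f j - e j) :=
    Finset.sum_le_univ_sum_of_nonneg fun j => sub_nonneg.2 (hle j)
  have := Finset.sum_le_sum fun j (_ : j ∈ J) => hle'' j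
  simp only [Finset.sum_sub_distrib] at hJ
  linarith

end IsEigenbasis

end Weyl

lemma exists_perm_comp_eq_of_map_univ_eq {n : ℕ} {f g : Fin n → ℝ}
    (h : Finset.univ.val.map f = Finset.univ.val.map g) :
    ∃ τ : Equiv.Perm (Fin n), ∀ j, f (τ j) = g j := by
  have hp : (List.ofFn (f ∘ Tuple.sort f)).Perm (List.ofFn (g ∘ Tuple.sort g)) := by
    refine ((Equiv.Perm.ofFn_comp_perm _ f).trans ?_).trans (Equiv.Perm.ofFn_comp_perm _ g).symm
    rwa [Fin.univ_val_map, Fin.univ_val_map, Multiset.coe_eq_coe] at h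
  have hs := hp.eq_of_sortedLE (Tuple.monotone_sort f).sortedLE_ofFn
    (Tuple.monotone_sort g).sortedLE_ofFn
  refine ⟨(Tuple.sort g).symm.trans (Tuple.sort f), fun j => ?_⟩
  simpa using congrFun (List.ofFn_injective hs) ((Tuple.sort g).symm j)

lemma SkewB2Realization.of_comp_perm {x y : Fin 3 → ℝ} (σ : Equiv.Perm (Fin 3))
    (h : SkewB2Realization (x ∘ σ) (y ∘ σ)) : SkewB2Realization x y := by
  obtain ⟨S, hS, hsum, hev⟩ := h
  refine ⟨S ∘ σ.symm, fun i => hS _, ?_, fun i => ?_⟩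
  · rw [← hsum]
    exact Equiv.sum_comp σ.symm S
  · simpa using hev (σ.symm i)

/-- The skew-symmetric matrix with off-diagonal block the `3 × 2` matrix with columns `u`, `w`. -/
def skewOfColumns (u w : Fin 3 → ℝ) : Matrix (Fin 5) (Fin 5) ℝ :=
  !![0, 0, 0, u 0, w 0;
     0, 0, 0, u 1, w 1;
     0, 0, 0, u 2, w 2;
     -u 0, -u 1, -u 2, 0, 0;
     -w 0, -w 1, -w 2, 0, 0]

lemma isHermitian_I_smul_map {n : Type*} {S : Matrix n n ℝ} (h : Sᵀ = -S) :
    (Complex.I • S.map (Complex.ofReal ·)).IsHermitian := by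
  ext i j
  have : S j i = -S i j := congrFun (congrFun h i) j
  simp [this]

lemma charpoly_skewOfColumns {x y : ℝ} {u w : Fin 3 → ℝ}
    (htr : u ⬝ᵥ u + w ⬝ᵥ w = x ^ 2 + y ^ 2)
    (hdet : (u ⬝ᵥ u) * (w ⬝ᵥ w) - (u ⬝ᵥ w) ^ 2 = (x * y) ^ 2) :
    (Complex.I • (skewOfColumns u w).map (Complex.ofReal ·)).charpoly =
      ∏ j, (Polynomial.X - Polynomial.C ((![x, y, 0, -y, -x] j : ℝ) : ℂ)) := by
  refine Polynomial.funext fun z => ?_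
  rw [Matrix.eval_charpoly]
  simp only [dotProduct, Fin.sum_univ_three] at htr hdet
  replace htr := congrArg ((↑) : ℝ → ℂ) htr
  replace hdet := congrArg ((↑) : ℝ → ℂ) hdet
  push_cast at htr hdet
  have hI2 : Complex.I ^ 2 = -1 := Complex.I_sq
  have hI4 : Complex.I ^ 4 = 1 := Complex.I_pow_four
  simp [skewOfColumns, det_succ_row_zero, Fin.sum_univ_succ, Fin.succAbove,
    Fin.prod_univ_succ, Matrix.scalar_apply]
  ring_nf
  simp only [hI2, hI4]
  linear_combination (-z ^ 3) * htr + z * hdet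

lemma skewB2Realization_of_columns {x y : Fin 3 → ℝ} (u w : Fin 3 → Fin 3 → ℝ)
    (hu : ∑ i, u i = 0) (hw : ∑ i, w i = 0)
    (htr : ∀ i, u i ⬝ᵥ u i + w i ⬝ᵥ w i = x i ^ 2 + y i ^ 2)
    (hdet : ∀ i, (u i ⬝ᵥ u i) * (w i ⬝ᵥ w i) - (u i ⬝ᵥ w i) ^ 2 = (x i * y i) ^ 2) :
    SkewB2Realization x y := by
  have hskew : ∀ i, (skewOfColumns (u i) (w i))ᵀ = -skewOfColumns (u i) (w i) := fun i => by
    ext a b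
    fin_cases a <;> fin_cases b <;> simp [skewOfColumns]
  refine ⟨fun i => skewOfColumns (u i) (w i), hskew, ?_, fun i =>
    ⟨isHermitian_I_smul_map (hskew i), exists_perm_comp_eq_of_map_univ_eq ?_⟩⟩
  · have hu' := fun k => congrFun hu k
    have hw' := fun k => congrFun hw k
    simp only [Fin.sum_univ_three, Pi.add_apply, Pi.zero_apply] at hu' hw'
    ext a b
    fin_cases a <;> fin_cases b <;>
      simp [skewOfColumns, Fin.sum_univ_three, hu', hw'] <;>
      linarith [hu' 0, hu' 1, hu' 2, hw' 0, hw' 1, hw' 2]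
  · have h := (isHermitian_I_smul_map (hskew i)).roots_charpoly_eq_eigenvalues
    rw [charpoly_skewOfColumns (htr i) (hdet i), Polynomial.roots_prod _ _
      (Finset.prod_ne_zero_iff.2 fun _ _ => Polynomial.X_sub_C_ne_zero _)] at h
    simp only [Polynomial.roots_X_sub_C, Multiset.bind_singleton] at h
    have h' := congrArg (Multiset.map Complex.re) h
    simpa [Multiset.map_map, Function.comp_def] using h'.symm

section Construction

variable {x₀ x₁ x₂ y₀ y₁ y₂ : ℝ}

lemma exists_add_two_mul_eq {N k t : ℝ} (hk : 0 ≤ k) (h₁ : N - 2 * k ≤ t) (h₂ : t ≤ N + 2 * k) :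
    ∃ c, -1 ≤ c ∧ c ≤ 1 ∧ N + 2 * k * c = t := by
  rcases hk.eq_or_lt with rfl | hk
  · exact ⟨0, by norm_num, by norm_num, by linarith⟩
  · refine ⟨(t - N) / (2 * k), ?_, ?_, by field_simp; ring⟩
    · rw [le_div_iff₀ (by positivity)]; linarith
    · rw [div_le_iff₀ (by positivity)]; linarith

lemma exists_sq_eq_sq_eq_mul_eq {s t r : ℝ} (hst : 0 ≤ s + t) (hr : r ^ 2 = s * t) :
    ∃ k l : ℝ, k ^ 2 = s ∧ l ^ 2 = t ∧ k * l = r := by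
  have hs : 0 ≤ s := by
    by_contra! hs
    nlinarith [mul_pos (neg_pos.2 hs) (by linarith : 0 < t)]
  have ht : 0 ≤ t := by
    by_contra! ht
    nlinarith [mul_pos (neg_pos.2 ht) (by linarith : 0 < s)]
  rcases hs.eq_or_lt with rfl | hs
  · exact ⟨0, √t, by simp, Real.sq_sqrt ht, by simp_all⟩
  · have hs' : √s ≠ 0 := (Real.sqrt_pos.2 hs).ne'
    refine ⟨√s, r / √s, Real.sq_sqrt hs.le, ?_, by field_simp⟩
    rw [div_pow, Real.sq_sqrt hs.le, hr]
    field_simp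

/-- Planar triangles with prescribed side lengths. -/
lemma exists_planar_triangle {p₀ p₁ p₂ : ℝ} (h₀ : 0 ≤ p₀) (h₁ : 0 ≤ p₁)
    (hl : (p₀ - p₁) ^ 2 ≤ p₂ ^ 2) (hu : p₂ ^ 2 ≤ (p₀ + p₁) ^ 2) :
    ∃ s t : ℝ, s ^ 2 + t ^ 2 = p₁ ^ 2 ∧ (p₀ + s) ^ 2 + t ^ 2 = p₂ ^ 2 := by
  obtain ⟨c, hc, hc', h⟩ := exists_add_two_mul_eq (N := p₀ ^ 2 + p₁ ^ 2) (t := p₂ ^ 2)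
    (mul_nonneg h₀ h₁) (by linarith) (by linarith)
  have hs : √(1 - c ^ 2) ^ 2 = 1 - c ^ 2 := Real.sq_sqrt (by nlinarith)
  refine ⟨p₁ * c, p₁ * √(1 - c ^ 2), ?_, ?_⟩
  · linear_combination p₁ ^ 2 * hs
  · linear_combination p₁ ^ 2 * hs + h

/-- Three realizing pairs of columns, the last one determined by the first two. -/
lemma skewB2Realization_of_two_columns (u₀ u₁ w₀ w₁ : Fin 3 → ℝ)
    (htr₀ : u₀ ⬝ᵥ u₀ + w₀ ⬝ᵥ w₀ = x₀ ^ 2 + y₀ ^ 2)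
    (hdet₀ : (u₀ ⬝ᵥ u₀) * (w₀ ⬝ᵥ w₀) - (u₀ ⬝ᵥ w₀) ^ 2 = (x₀ * y₀) ^ 2)
    (htr₁ : u₁ ⬝ᵥ u₁ + w₁ ⬝ᵥ w₁ = x₁ ^ 2 + y₁ ^ 2)
    (hdet₁ : (u₁ ⬝ᵥ u₁) * (w₁ ⬝ᵥ w₁) - (u₁ ⬝ᵥ w₁) ^ 2 = (x₁ * y₁) ^ 2)
    (htr₂ : (u₀ + u₁) ⬝ᵥ (u₀ + u₁) + (w₀ + w₁) ⬝ᵥ (w₀ + w₁) = x₂ ^ 2 + y₂ ^ 2)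
    (hdet₂ : ((u₀ + u₁) ⬝ᵥ (u₀ + u₁)) * ((w₀ + w₁) ⬝ᵥ (w₀ + w₁)) -
      ((u₀ + u₁) ⬝ᵥ (w₀ + w₁)) ^ 2 = (x₂ * y₂) ^ 2) :
    SkewB2Realization ![x₀, x₁, x₂] ![y₀, y₁, y₂] := by
  refine skewB2Realization_of_columns ![u₀, u₁, -(u₀ + u₁)] ![w₀, w₁, -(w₀ + w₁)]
    (by simp [Fin.sum_univ_three]) (by simp [Fin.sum_univ_three]) ?_ ?_
  · intro i
    fin_cases i
    · exact htr₀
    · exact htr₁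
    · simpa only [Fin.reduceFinMk, cons_val, neg_dotProduct_neg] using htr₂
  · intro i
    fin_cases i
    · exact hdet₀
    · exact hdet₁
    · simpa only [Fin.reduceFinMk, cons_val, neg_dotProduct_neg] using hdet₂

/-- Realizations by `2 × 2` blocks, corresponding to `𝔰𝔬(4) = 𝔰𝔬(3) × 𝔰𝔬(3)`: a pair of planar
triangles with side lengths `a₀, a₁, a₂` and `b₀, b₁, b₂`. -/
lemma skewB2Realization_of_planar {a₀ a₁ a₂ b₀ b₁ b₂ : ℝ}
    (ha₀ : 0 ≤ a₀) (ha₁ : 0 ≤ a₁) (hb₀ : 0 ≤ b₀) (hb₁ : 0 ≤ b₁)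
    (hal : (a₀ - a₁) ^ 2 ≤ a₂ ^ 2) (hau : a₂ ^ 2 ≤ (a₀ + a₁) ^ 2)
    (hbl : (b₀ - b₁) ^ 2 ≤ b₂ ^ 2) (hbu : b₂ ^ 2 ≤ (b₀ + b₁) ^ 2)
    (htr₀ : a₀ ^ 2 + b₀ ^ 2 = 2 * (x₀ ^ 2 + y₀ ^ 2))
    (hdet₀ : (a₀ ^ 2 - b₀ ^ 2) ^ 2 = 16 * (x₀ * y₀) ^ 2)
    (htr₁ : a₁ ^ 2 + b₁ ^ 2 = 2 * (x₁ ^ 2 + y₁ ^ 2))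
    (hdet₁ : (a₁ ^ 2 - b₁ ^ 2) ^ 2 = 16 * (x₁ * y₁) ^ 2)
    (htr₂ : a₂ ^ 2 + b₂ ^ 2 = 2 * (x₂ ^ 2 + y₂ ^ 2))
    (hdet₂ : (a₂ ^ 2 - b₂ ^ 2) ^ 2 = 16 * (x₂ * y₂) ^ 2) :
    SkewB2Realization ![x₀, x₁, x₂] ![y₀, y₁, y₂] := by
  obtain ⟨s, t, hst, hst'⟩ := exists_planar_triangle ha₀ ha₁ hal hau
  obtain ⟨p, q, hpq, hpq'⟩ := exists_planar_triangle hb₀ hb₁ hbl hbu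
  refine skewB2Realization_of_two_columns ![(a₀ + b₀) / 2, 0, 0] ![(s + p) / 2, (t + q) / 2, 0]
    ![0, (a₀ - b₀) / 2, 0] ![-(t - q) / 2, (s - p) / 2, 0] ?_ ?_ ?_ ?_ ?_ ?_ <;>
    simp only [dotProduct, Fin.sum_univ_three, Pi.add_apply, cons_val]
  · linear_combination htr₀ / 2
  · linear_combination hdet₀ / 16
  · linear_combination htr₁ / 2 + (hst + hpq) / 2
  · rw [← hst, ← hpq] at hdet₁
    linear_combination hdet₁ / 16
  · linear_combination htr₂ / 2 + (hst' + hpq') / 2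
  · rw [← hst', ← hpq'] at hdet₂
    linear_combination hdet₂ / 16

/-- Realizations in which the first two blocks have aligned right singular vectors. The numbers
`C ± D`, `d ± p` are the entries of a `2 × 2` block of an orthogonal `3 × 3` matrix. -/
lemma skewB2Realization_of_aligned {P C D p d : ℝ} (hP₀ : 0 ≤ P) (hP₁ : P ≤ 1)
    (hp : p ^ 2 = P ^ 2 - C ^ 2) (hd : d ^ 2 = (1 - P) ^ 2 - D ^ 2)
    (htr : (x₀ ^ 2 + x₁ ^ 2 + 2 * x₀ * x₁ * (C + D)) +
      (y₀ ^ 2 + y₁ ^ 2 + 2 * y₀ * y₁ * (C - D)) = x₂ ^ 2 + y₂ ^ 2)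
    (hdet : (x₀ ^ 2 + x₁ ^ 2 + 2 * x₀ * x₁ * (C + D)) *
      (y₀ ^ 2 + y₁ ^ 2 + 2 * y₀ * y₁ * (C - D)) -
      (x₀ * y₁ * (d - p) + x₁ * y₀ * (d + p)) ^ 2 = (x₂ * y₂) ^ 2) :
    SkewB2Realization ![x₀, x₁, x₂] ![y₀, y₁, y₂] := by
  obtain ⟨k, l, hk, hl, hkl⟩ := exists_sq_eq_sq_eq_mul_eq
    (s := 2 * (P * (1 - P) - C * D - p * d)) (t := 2 * (P * (1 - P) + C * D + p * d))
    (r := 2 * (D * p - C * d)) (by nlinarith) (by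
      linear_combination (4 * D ^ 2 + 4 * d ^ 2) * hp + 4 * P ^ 2 * hd)
  have hu : (C + D) ^ 2 + (d + p) ^ 2 + k ^ 2 = 1 := by linear_combination hk + hp + hd
  have hw : (C - D) ^ 2 + (d - p) ^ 2 + l ^ 2 = 1 := by linear_combination hl + hp + hd
  have huw : (C + D) * (d - p) + (d + p) * (C - D) + k * l = 0 := by linear_combination hkl
  have h₂u : (x₀ + x₁ * (C + D)) ^ 2 + (x₁ * (d + p)) ^ 2 + (x₁ * k) ^ 2 =
      x₀ ^ 2 + x₁ ^ 2 + 2 * x₀ * x₁ * (C + D) := by linear_combination x₁ ^ 2 * hu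
  have h₂w : (y₁ * (d - p)) ^ 2 + (y₀ + y₁ * (C - D)) ^ 2 + (y₁ * l) ^ 2 =
      y₀ ^ 2 + y₁ ^ 2 + 2 * y₀ * y₁ * (C - D) := by linear_combination y₁ ^ 2 * hw
  have h₂uw : (x₀ + x₁ * (C + D)) * (y₁ * (d - p)) + x₁ * (d + p) * (y₀ + y₁ * (C - D)) +
      x₁ * k * (y₁ * l) = x₀ * y₁ * (d - p) + x₁ * y₀ * (d + p) := by
    linear_combination x₁ * y₁ * huw
  rw [← h₂u, ← h₂w] at htr hdet
  rw [← h₂uw] at hdet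
  have h₁u : (x₁ * (C + D)) ^ 2 + (x₁ * (d + p)) ^ 2 + (x₁ * k) ^ 2 = x₁ ^ 2 := by
    linear_combination x₁ ^ 2 * hu
  have h₁w : (y₁ * (d - p)) ^ 2 + (y₁ * (C - D)) ^ 2 + (y₁ * l) ^ 2 = y₁ ^ 2 := by
    linear_combination y₁ ^ 2 * hw
  have h₁uw : x₁ * (C + D) * (y₁ * (d - p)) + x₁ * (d + p) * (y₁ * (C - D)) +
      x₁ * k * (y₁ * l) = 0 := by
    linear_combination x₁ * y₁ * huw
  refine skewB2Realization_of_two_columns ![x₀, 0, 0] ![x₁ * (C + D), x₁ * (d + p), x₁ * k]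
    ![0, y₀, 0] ![y₁ * (d - p), y₁ * (C - D), y₁ * l] ?_ ?_ ?_ ?_ ?_ ?_ <;>
    simp only [dotProduct, Fin.sum_univ_three, Pi.add_apply, cons_val, ← sq, zero_add]
  · ring
  · ring
  · rw [h₁u, h₁w]
  · rw [h₁u, h₁w, h₁uw]
    ring
  · exact htr
  · exact hdet

/-- The case where both `(x₀, x₁, x₂)` and `(y₀, y₁, y₂)` are side lengths of triangles. -/
lemma skewB2Realization_of_triangles (hx₀ : 0 ≤ x₀) (hx₁ : 0 ≤ x₁) (hy₀ : 0 ≤ y₀) (hy₁ : 0 ≤ y₁)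
    (hxl : (x₀ - x₁) ^ 2 ≤ x₂ ^ 2) (hxu : x₂ ^ 2 ≤ (x₀ + x₁) ^ 2)
    (hyl : (y₀ - y₁) ^ 2 ≤ y₂ ^ 2) (hyu : y₂ ^ 2 ≤ (y₀ + y₁) ^ 2) :
    SkewB2Realization ![x₀, x₁, x₂] ![y₀, y₁, y₂] := by
  obtain ⟨m, hm, hm', hmx⟩ := exists_add_two_mul_eq (N := x₀ ^ 2 + x₁ ^ 2) (t := x₂ ^ 2)
    (mul_nonneg hx₀ hx₁) (by linarith) (by linarith)
  obtain ⟨m', hm₁, hm₁', hmy⟩ := exists_add_two_mul_eq (N := y₀ ^ 2 + y₁ ^ 2) (t := y₂ ^ 2)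
    (mul_nonneg hy₀ hy₁) (by linarith) (by linarith)
  set C := (m + m') / 2 with hC
  set D := (m - m') / 2 with hD
  have hCD : |C| ≤ 1 - |D| := by
    rcases abs_cases C with h | h <;> rcases abs_cases D with h' | h' <;> linarith
  set α := x₁ * y₀ - x₀ * y₁
  set β := x₁ * y₀ + x₀ * y₁
  have hβ : 0 ≤ β := by positivity
  let f : ℝ → ℝ := fun P => β * √((1 - P) ^ 2 - D ^ 2) - |α| * √(P ^ 2 - C ^ 2)
  have hf : Continuous f := by fun_prop
  obtain ⟨P, ⟨hP, hP'⟩, h0⟩ : (0 : ℝ) ∈ f '' Set.Icc |C| (1 - |D|) := by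
    refine intermediate_value_Icc' hCD hf.continuousOn ⟨?_, ?_⟩
    · simp only [f, sub_sub_cancel, sq_abs, sub_self, Real.sqrt_zero, mul_zero, zero_sub,
        neg_nonpos]
      positivity
    · simp only [f, sq_abs, sub_self, Real.sqrt_zero, mul_zero, sub_zero]
      positivity
  have hPC : √(P ^ 2 - C ^ 2) ^ 2 = P ^ 2 - C ^ 2 := Real.sq_sqrt (sub_nonneg.2 (by
    rw [← sq_abs C]; exact pow_le_pow_left₀ (abs_nonneg _) hP 2))
  have hPD : √((1 - P) ^ 2 - D ^ 2) ^ 2 = (1 - P) ^ 2 - D ^ 2 := Real.sq_sqrt (sub_nonneg.2 (by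
    rw [← sq_abs D]; exact pow_le_pow_left₀ (abs_nonneg _) (by linarith) 2))
  obtain ⟨p, hp, hαp⟩ : ∃ p, p ^ 2 = P ^ 2 - C ^ 2 ∧ α * p = -(|α| * √(P ^ 2 - C ^ 2)) := by
    rcases abs_cases α with ⟨h, -⟩ | ⟨h, -⟩
    · exact ⟨-√(P ^ 2 - C ^ 2), by rw [neg_sq, hPC], by rw [h]; ring⟩
    · exact ⟨√(P ^ 2 - C ^ 2), hPC, by rw [h]; ring⟩
  have hx : x₀ ^ 2 + x₁ ^ 2 + 2 * x₀ * x₁ * (C + D) = x₂ ^ 2 := by rw [hC, hD, ← hmx]; ring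
  have hy : y₀ ^ 2 + y₁ ^ 2 + 2 * y₀ * y₁ * (C - D) = y₂ ^ 2 := by rw [hC, hD, ← hmy]; ring
  have hm0 : x₀ * y₁ * (√((1 - P) ^ 2 - D ^ 2) - p) +
      x₁ * y₀ * (√((1 - P) ^ 2 - D ^ 2) + p) = 0 := by
    have : α * p + β * √((1 - P) ^ 2 - D ^ 2) = 0 := by rw [hαp, ← h0]; ring
    rw [← this]; ring
  refine skewB2Realization_of_aligned ((abs_nonneg _).trans hP)
    (by linarith [abs_nonneg D]) hp hPD (by rw [hx, hy]) ?_
  rw [hx, hy, hm0]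
  ring

/-- Aligned realizations with the right trace and `D = 0` have too small a second invariant, unless
there is a planar realization. -/
lemma sq_add_mul_le_sq {c : ℝ} (hx₀ : y₀ ≤ x₀) (hx₁ : y₁ ≤ x₁) (hx₂ : y₂ ≤ x₂)
    (hy₀ : 0 ≤ y₀) (hy₁ : 0 ≤ y₁) (hb : (x₀ - y₀) + (x₂ - y₂) ≤ x₁ - y₁)
    (hplanar : x₂ - y₂ ≤ |(x₀ + y₀) - (x₁ + y₁)| ∨ (x₀ - y₀) + (x₁ - y₁) ≤ x₂ + y₂)
    (hc : -1 ≤ c) (hc' : c ≤ 1)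
    (hctr : x₀ ^ 2 + x₁ ^ 2 + (y₀ ^ 2 + y₁ ^ 2) + 2 * (x₀ * x₁ + y₀ * y₁) * c = x₂ ^ 2 + y₂ ^ 2) :
    (x₀ * y₀ + x₁ * y₁ + (x₀ * y₁ + x₁ * y₀) * c) ^ 2 ≤ (x₂ * y₂) ^ 2 := by
  have haa : 0 ≤ (x₀ + y₀) * (x₁ + y₁) := mul_nonneg (by linarith) (by linarith)
  have hbb : 0 ≤ (x₀ - y₀) * (x₁ - y₁) := mul_nonneg (by linarith) (by linarith)
  have hac := mul_nonneg haa (by linarith : 0 ≤ 1 + c)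
  have hbc := mul_nonneg hbb (by linarith : 0 ≤ 1 + c)
  have hbc' := mul_nonneg hbb (by linarith : 0 ≤ 1 - c)
  have hBl : (x₂ - y₂) ^ 2 ≤ ((x₁ - y₁) - (x₀ - y₀)) ^ 2 :=
    pow_le_pow_left₀ (by linarith) (by linarith) 2
  refine sq_le_sq' ?_ (by linarith)
  rcases hplanar with h | h
  · have hAl := pow_le_pow_left₀ (by linarith) h 2
    rw [sq_abs] at hAl
    linarith
  · have hBu := pow_le_pow_left₀ (by linarith) h 2
    linarith

/-- The case where `y₀` and `x₁ - y₁` violate the respective triangle inequalities: the intermediate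
value theorem along a segment of aligned realizations with fixed trace. -/
lemma skewB2Realization_of_lt_of_lt (hx₀ : y₀ ≤ x₀) (hx₁ : y₁ ≤ x₁) (hx₂ : y₂ ≤ x₂)
    (hy₀ : 0 ≤ y₀) (hy₁ : 0 ≤ y₁) (hy₂ : 0 ≤ y₂)
    (hy : y₁ + y₂ < y₀) (hb : (x₀ - y₀) + (x₂ - y₂) < x₁ - y₁)
    (hxu : x₂ ≤ x₀ + x₁) (hxl : x₀ - x₁ ≤ x₂) (hxl' : x₁ - x₀ ≤ x₂) (hyl : y₀ - y₁ ≤ x₂)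
    (ha : (x₀ + y₀) - (x₁ + y₁) ≤ x₂ + y₂) (hb' : (x₁ - y₁) - (x₀ - y₀) ≤ x₂ + y₂) :
    SkewB2Realization ![x₀, x₁, x₂] ![y₀, y₁, y₂] := by
  by_cases hplanar : |(x₀ + y₀) - (x₁ + y₁)| ≤ x₂ - y₂ ∧ x₂ + y₂ ≤ (x₀ - y₀) + (x₁ - y₁)
  · obtain ⟨h₁, h₂⟩ := hplanar
    refine skewB2Realization_of_planar (a₀ := x₀ + y₀) (a₁ := x₁ + y₁) (a₂ := x₂ - y₂)
      (b₀ := x₀ - y₀) (b₁ := x₁ - y₁) (b₂ := x₂ + y₂) (by linarith) (by linarith) (by linarith)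
      (by linarith) (sq_le_sq.2 (h₁.trans (le_abs_self _)))
      (pow_le_pow_left₀ (by linarith) (by linarith) 2) (sq_le_sq' (by linarith) (by linarith))
      (pow_le_pow_left₀ (by linarith) h₂ 2) ?_ ?_ ?_ ?_ ?_ ?_ <;> ring
  have hmin : (x₀ - x₁) ^ 2 + (y₀ - y₁) ^ 2 ≤ x₂ ^ 2 + y₂ ^ 2 := by
    rw [← sq_abs (x₀ - x₁)]
    have h₁ : |x₀ - x₁| ≤ x₂ := abs_le.2 ⟨by linarith, by linarith⟩
    have h₂ : |x₀ - x₁| + (y₀ - y₁) ≤ x₂ + y₂ := by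
      rcases abs_cases (x₀ - x₁) with h | h <;> linarith
    have h₃ := abs_nonneg (x₀ - x₁)
    rcases le_total (|x₀ - x₁| + (y₀ - y₁)) x₂ with h | h
    · nlinarith
    · nlinarith [mul_nonneg (sub_nonneg.2 h₁) (sub_nonneg.2 hyl)]
  have hxx : 0 ≤ x₀ * x₁ := mul_nonneg (by linarith) (by linarith)
  have hyy : 0 ≤ y₀ * y₁ := mul_nonneg hy₀ hy₁
  have hxsq : x₂ ^ 2 ≤ (x₀ + x₁) ^ 2 := pow_le_pow_left₀ (by linarith) hxu 2
  have hysq : y₂ ^ 2 ≤ (y₀ - y₁) ^ 2 := pow_le_pow_left₀ hy₂ (by linarith) 2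
  obtain ⟨c, hc, hc', hctr⟩ := exists_add_two_mul_eq
    (N := x₀ ^ 2 + x₁ ^ 2 + (y₀ ^ 2 + y₁ ^ 2)) (t := x₂ ^ 2 + y₂ ^ 2)
    (add_nonneg hxx hyy) (by linarith) (by nlinarith)
  obtain ⟨μ, hμ, hμ', hμtr⟩ := exists_add_two_mul_eq (N := x₀ ^ 2 + x₁ ^ 2)
    (t := x₂ ^ 2 + y₂ ^ 2 - (y₀ - y₁) ^ 2) hxx (by linarith) (by linarith)
  let C : ℝ → ℝ := fun s => (1 - s) * c + s * ((μ - 1) / 2)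
  let D : ℝ → ℝ := fun s => s * ((μ + 1) / 2)
  let f : ℝ → ℝ := fun s => (x₀ ^ 2 + x₁ ^ 2 + 2 * x₀ * x₁ * (C s + D s)) *
      (y₀ ^ 2 + y₁ ^ 2 + 2 * y₀ * y₁ * (C s - D s)) -
      (x₁ * y₀ - x₀ * y₁) ^ 2 * ((1 - D s) ^ 2 - C s ^ 2)
  have hf : Continuous f := by fun_prop
  obtain ⟨s, ⟨hs₀, hs₁⟩, hs⟩ : (x₂ * y₂) ^ 2 ∈ f '' Set.Icc 0 1 := by
    refine intermediate_value_Icc zero_le_one hf.continuousOn ⟨?_, ?_⟩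
    · have h0 : f 0 = (x₀ * y₀ + x₁ * y₁ + (x₀ * y₁ + x₁ * y₀) * c) ^ 2 := by
        simp only [f, C, D]; ring
      rw [h0]
      refine sq_add_mul_le_sq hx₀ hx₁ hx₂ hy₀ hy₁ hb.le ?_ hc hc' hctr
      rw [not_and_or, not_le, not_le] at hplanar
      exact hplanar.imp le_of_lt le_of_lt
    · have h1 : f 1 = (x₂ ^ 2 + y₂ ^ 2 - (y₀ - y₁) ^ 2) * (y₀ - y₁) ^ 2 := by
        rw [← hμtr]; simp only [f, C, D]; ring
      have hysq' : (y₀ - y₁) ^ 2 ≤ x₂ ^ 2 := pow_le_pow_left₀ (by linarith) hyl 2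
      rw [h1]
      nlinarith [mul_nonneg (sub_nonneg.2 hysq) (sub_nonneg.2 hysq')]
  have hPC : 0 ≤ (1 - D s) ^ 2 - C s ^ 2 := by
    have h₁ : 0 ≤ 1 - D s - C s := by
      have : 1 - D s - C s = (1 - s) * (1 - c) + s * (1 - μ) := by simp only [C, D]; ring
      rw [this]
      exact add_nonneg (mul_nonneg (by linarith) (by linarith)) (mul_nonneg hs₀ (by linarith))
    have h₂ : 0 ≤ 1 - D s + C s := by
      have : 1 - D s + C s = (1 - s) * (1 + c) := by simp only [C, D]; ring
      rw [this]
      exact mul_nonneg (by linarith) (by linarith)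
    nlinarith [mul_nonneg h₁ h₂]
  have hD₀ : 0 ≤ D s := mul_nonneg hs₀ (by linarith)
  have hD₁ : D s ≤ 1 := mul_le_one₀ hs₁ (by linarith) (by linarith)
  refine skewB2Realization_of_aligned (P := 1 - D s) (C := C s) (D := D s) (d := 0)
    (sub_nonneg.2 hD₁) (by linarith) (Real.sq_sqrt hPC) (by ring) ?_ ?_
  · simp only [C, D]
    linear_combination (1 - s) * hctr + s * hμtr
  · rw [← hs]
    simp only [f]
    linear_combination (-(x₁ * y₀ - x₀ * y₁) ^ 2) * Real.sq_sqrt hPC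

end Construction

lemma forall_mem_B2Ineqs {x y : Fin 3 → ℝ} :
    (∀ f ∈ B2Ineqs, f (x, y) ≤ 0) ↔ ∀ σ : Equiv.Perm (Fin 3),
      x (σ 0) ≤ x (σ 1) + x (σ 2) ∧ y (σ 0) - y (σ 1) ≤ x (σ 2) ∧
      x (σ 0) + y (σ 0) ≤ (x (σ 1) + y (σ 1)) + (x (σ 2) + y (σ 2)) ∧
      (x (σ 0) - y (σ 0)) - (x (σ 1) - y (σ 1)) ≤ x (σ 2) + y (σ 2) := by
  simp only [B2Ineqs, Set.mem_iUnion, forall_exists_index]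
  rw [forall_comm]
  refine forall_congr' fun σ => ?_
  simp only [Set.mem_insert_iff, Set.mem_singleton_iff, forall_eq_or_imp, forall_eq]
  refine and_congr ?_ (and_congr ?_ (and_congr ?_ ?_)) <;> constructor <;> intro h <;> linarith

section Necessity

lemma antitone_of_b2Chamber {x y : ℝ} (hx : y ≤ x) (hy : 0 ≤ y) :
    Antitone ![x, y, 0, -y, -x] := by
  refine Fin.antitone_iff_succ_le.2 fun i => ?_
  fin_cases i <;> simp <;> linarith

lemma IsEigenbasis.of_eigenvalues {A : Matrix (Fin 5) (Fin 5) ℂ} (h : A.IsHermitian)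
    {τ : Equiv.Perm (Fin 5)} {e : Fin 5 → ℝ} (hτ : ∀ j, h.eigenvalues (τ j) = e j) :
    IsEigenbasis (toEuclideanLin A) (h.eigenvectorBasis.reindex τ.symm) e := by
  intro j
  rw [OrthonormalBasis.reindex_apply, Equiv.symm_symm, ← hτ, Complex.coe_smul]
  apply WithLp.ofLp_injective
  simpa using h.mulVec_eigenvectorBasis (τ j)

lemma IsEigenbasis.neg_rev {E : Type*} [NormedAddCommGroup E] [InnerProductSpace ℂ E]
    {T : E →ₗ[ℂ] E} {b : OrthonormalBasis (Fin 5) ℂ E} {x y : ℝ}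
    (h : IsEigenbasis T b ![x, y, 0, -y, -x]) :
    IsEigenbasis (-T) (b.reindex Fin.revPerm) ![x, y, 0, -y, -x] := by
  intro j
  rw [OrthonormalBasis.reindex_apply, LinearMap.neg_apply, h, ← neg_smul]
  fin_cases j <;> simp [Fin.rev]

lemma SkewB2Realization.forall_le {x y : Fin 3 → ℝ} (hxy : B2Chamber x y)
    (h : SkewB2Realization x y) (σ : Equiv.Perm (Fin 3)) :
      x (σ 0) ≤ x (σ 1) + x (σ 2) ∧ y (σ 0) - y (σ 1) ≤ x (σ 2) ∧
      x (σ 0) + y (σ 0) ≤ (x (σ 1) + y (σ 1)) + (x (σ 2) + y (σ 2)) ∧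
      (x (σ 0) - y (σ 0)) - (x (σ 1) - y (σ 1)) ≤ x (σ 2) + y (σ 2) := by
  obtain ⟨S, -, hsum, hev⟩ := h
  choose hS τ hτ using hev
  let T : Fin 3 → EuclideanSpace ℂ (Fin 5) →ₗ[ℂ] EuclideanSpace ℂ (Fin 5) := fun i =>
    toEuclideanLin (Complex.I • (S i).map (Complex.ofReal ·))
  have hT : ∀ i, IsEigenbasis (T i) _ _ := fun i => .of_eigenvalues (hS i) (hτ i)
  have hanti := fun i => antitone_of_b2Chamber (hxy i).1 (hxy i).2
  have hsumT : T (σ 1) + T (σ 2) = -T (σ 0) := by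
    rw [eq_neg_iff_add_eq_zero, ← map_add, ← map_add, ← smul_add, ← smul_add]
    rw [← Equiv.sum_comp σ, Fin.sum_univ_three] at hsum
    have : (S (σ 1)).map (Complex.ofReal ·) + (S (σ 2)).map (Complex.ofReal ·) +
        (S (σ 0)).map (Complex.ofReal ·) = 0 := by
      ext a b
      have := congrFun (congrFun hsum a) b
      simp only [Matrix.add_apply, Matrix.zero_apply] at this
      simp only [Matrix.add_apply, map_apply, Matrix.zero_apply]
      norm_cast
      linarith
    rw [this, smul_zero, map_zero]
  have h'' : IsEigenbasis (T (σ 1) + T (σ 2)) _ _ := hsumT ▸ (hT (σ 0)).neg_rev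
  have hc : ∀ j, ![x (σ 2), y (σ 2), 0, -y (σ 2), -x (σ 2)] j ≤ x (σ 2) := fun j =>
    hanti (σ 2) (Fin.zero_le j)
  have hpos : ∑ j, max (![x (σ 2), y (σ 2), 0, -y (σ 2), -x (σ 2)] j) 0 = x (σ 2) + y (σ 2) := by
    obtain ⟨hx, hy⟩ := hxy (σ 2)
    simp [Fin.sum_univ_succ, hy, hy.trans hx]
  have h₀ := (hT (σ 1)).add_le (hT (σ 2)) h'' (hanti _) (hanti _) hc 0
  have h₁ := (hT (σ 1)).add_le (hT (σ 2)) h'' (hanti _) (hanti _) hc 1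
  have h₂ := (hT (σ 1)).sum_add_le (hT (σ 2)) h'' (hanti _) (hanti _) {0, 1}
  have h₃ := (hT (σ 1)).sum_add_le (hT (σ 2)) h'' (hanti _) (hanti _) {0, 3}
  rw [hpos, Finset.sum_pair (by decide), Finset.sum_pair (by decide)] at h₂ h₃
  simp only [cons_val] at h₀ h₁ h₂ h₃
  exact ⟨h₀, by linarith, by linarith, by linarith⟩

end Necessity

section Sufficiency

variable {x y : Fin 3 → ℝ}

lemma skewB2Realization_of_forall_le (hxy : B2Chamber x y)
    (h : ∀ σ : Equiv.Perm (Fin 3), x (σ 0) ≤ x (σ 1) + x (σ 2) ∧ y (σ 0) - y (σ 1) ≤ x (σ 2) ∧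
      x (σ 0) + y (σ 0) ≤ (x (σ 1) + y (σ 1)) + (x (σ 2) + y (σ 2)) ∧
      (x (σ 0) - y (σ 0)) - (x (σ 1) - y (σ 1)) ≤ x (σ 2) + y (σ 2)) :
    SkewB2Realization x y := by
  have heta : ∀ w : Fin 3 → ℝ, ![w 0, w 1, w 2] = w := fun w => by
    ext i; fin_cases i <;> rfl
  have hsum : ∀ (w : Fin 3 → ℝ) (σ : Equiv.Perm (Fin 3)),
      w (σ 0) + w (σ 1) + w (σ 2) = w 0 + w 1 + w 2 := fun w σ => by
    simpa [Fin.sum_univ_three] using Equiv.sum_comp σ w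
  have hσ : ∀ i l : Fin 3, i ≠ l → ∃ σ : Equiv.Perm (Fin 3), σ 0 = i ∧ σ 1 = l := by decide
  have htri : ∀ w : Fin 3 → ℝ, (∀ σ : Equiv.Perm (Fin 3), w (σ 0) ≤ w (σ 1) + w (σ 2)) →
      ∀ i, 2 * w i ≤ w 0 + w 1 + w 2 := fun w hw i => by
    obtain ⟨l, hl⟩ := exists_ne i
    obtain ⟨σ, rfl, -⟩ := hσ i l hl.symm
    linarith [hw σ, hsum w σ]
  have hx := htri x fun σ => (h σ).1
  have ha := htri (fun i => x i + y i) fun σ => (h σ).2.2.1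
  have hx₀ := fun i => (hxy i).2.trans (hxy i).1
  by_cases hy : ∀ i, 2 * y i ≤ y 0 + y 1 + y 2
  · rw [← heta x, ← heta y]
    have hy₀ := fun i => (hxy i).2
    exact skewB2Realization_of_triangles (hx₀ 0) (hx₀ 1) (hy₀ 0) (hy₀ 1)
      (sq_le_sq' (by linarith [hx 1]) (by linarith [hx 0]))
      (pow_le_pow_left₀ (hx₀ 2) (by linarith [hx 2]) 2)
      (sq_le_sq' (by linarith [hy 1]) (by linarith [hy 0]))
      (pow_le_pow_left₀ (hy₀ 2) (by linarith [hy 2]) 2)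
  by_cases hb : ∀ i, 2 * (x i - y i) ≤ (x 0 - y 0) + (x 1 - y 1) + (x 2 - y 2)
  · rw [← heta x, ← heta y]
    have ha₀ := fun i => add_nonneg (hx₀ i) (hxy i).2
    have hb₀ := fun i => sub_nonneg.2 (hxy i).1
    refine skewB2Realization_of_planar (ha₀ 0) (ha₀ 1) (hb₀ 0) (hb₀ 1)
      (a₂ := x 2 + y 2) (b₂ := x 2 - y 2)
      (sq_le_sq' (by linarith [ha 1]) (by linarith [ha 0]))
      (pow_le_pow_left₀ (ha₀ 2) (by linarith [ha 2]) 2)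
      (sq_le_sq' (by linarith [hb 1]) (by linarith [hb 0]))
      (pow_le_pow_left₀ (hb₀ 2) (by linarith [hb 2]) 2) ?_ ?_ ?_ ?_ ?_ ?_ <;> ring
  push Not at hy hb
  obtain ⟨i, hi⟩ := hy
  obtain ⟨l, hl⟩ := hb
  have hil : i ≠ l := by
    rintro rfl
    linarith [hx i]
  obtain ⟨σ, rfl, rfl⟩ := hσ i l hil
  obtain ⟨-, h₂, h₃, -⟩ := h σ
  have h₄ : (x (σ 1) - y (σ 1)) - (x (σ 0) - y (σ 0)) ≤ x (σ 2) + y (σ 2) := by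
    simpa [Equiv.swap_apply_of_ne_of_ne] using (h ((Equiv.swap 0 1).trans σ)).2.2.2
  have hxσ := hsum x σ
  have hyσ := hsum y σ
  refine SkewB2Realization.of_comp_perm σ ?_
  rw [← heta (x ∘ σ), ← heta (y ∘ σ)]
  simp only [Function.comp_apply]
  exact skewB2Realization_of_lt_of_lt (hxy (σ 0)).1 (hxy (σ 1)).1 (hxy (σ 2)).1 (hxy (σ 0)).2
    (hxy (σ 1)).2 (hxy (σ 2)).2 (by linarith) (by linarith) (by linarith [hx (σ 2)])
    (by linarith [hx (σ 0)]) (by linarith [hx (σ 1)]) (by linarith) (by linarith) h₄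

end Sufficiency

section Irredundancy

/-- The four types of stability functionals, for an ordering `(i, j, k)` of the indices. -/
def b2Functional (t : Fin 4) (i j k : Fin 3) : (Fin 3 → ℝ) × (Fin 3 → ℝ) → ℝ :=
  ![fun p => p.1 i - p.1 j - p.1 k,
    fun p => p.2 i - p.2 j - p.1 k,
    fun p => (p.1 i + p.2 i) - (p.1 j + p.2 j) - (p.1 k + p.2 k),
    fun p => (p.1 i - p.2 i) - (p.1 j - p.2 j) - (p.1 k + p.2 k)] t

lemma mem_B2Ineqs {f : (Fin 3 → ℝ) × (Fin 3 → ℝ) → ℝ} :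
    f ∈ B2Ineqs ↔
      ∃ (σ : Equiv.Perm (Fin 3)) (t : Fin 4), f = b2Functional t (σ 0) (σ 1) (σ 2) := by
  simp [B2Ineqs, b2Functional, Fin.exists_fin_succ]

lemma b2Functional_perm (t : Fin 4) (i j k : Fin 3) (σ : Equiv.Perm (Fin 3))
    (p : (Fin 3 → ℝ) × (Fin 3 → ℝ)) :
    b2Functional t (σ i) (σ j) (σ k) p = b2Functional t i j k (p.1 ∘ σ, p.2 ∘ σ) := by
  fin_cases t <;> rfl

lemma exists_witness (t : Fin 4) : ∃ x y : Fin 3 → ℝ, B2Chamber x y ∧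
    0 < b2Functional t 0 1 2 (x, y) ∧ ∀ (s : Fin 4) (i j k : Fin 3), i ≠ j → i ≠ k → j ≠ k →
      b2Functional s i j k (x, y) ≤ 0 ∨ b2Functional s i j k = b2Functional t 0 1 2 := by
  refine ⟨![![5, 2, 2], ![10, 10, 9], ![7, 4, 4], ![10, 5, 9]] t,
    ![![2, 2, 2], ![10, 0, 9], ![3, 0, 0], ![0, 5, 0]] t, fun i => ?_, ?_, ?_⟩
  · fin_cases t <;> fin_cases i <;> norm_num
  · fin_cases t <;> simp only [b2Functional, Fin.isValue, Fin.reduceFinMk, cons_val] <;>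
      norm_num
  · intro s i j k hij hik hjk
    fin_cases t <;> fin_cases s <;> fin_cases i <;> fin_cases j <;>
      first
      | exact absurd rfl hij
      | fin_cases k <;>
        first
        | exact absurd rfl hik
        | exact absurd rfl hjk
        | exact Or.inr rfl
        | (left; norm_num [b2Functional]; done)
        | (right; funext p; simp [b2Functional]; ring)

lemma B2Ineqs_irredundant {f : (Fin 3 → ℝ) × (Fin 3 → ℝ) → ℝ} (hf : f ∈ B2Ineqs) :
    ∃ x y : Fin 3 → ℝ, B2Chamber x y ∧ (∀ g ∈ B2Ineqs, g ≠ f → g (x, y) ≤ 0) ∧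
      0 < f (x, y) := by
  obtain ⟨σ, t, rfl⟩ := mem_B2Ineqs.1 hf
  obtain ⟨x, y, hxy, hpos, hle⟩ := exists_witness t
  have hcomp : ∀ w : Fin 3 → ℝ, (w ∘ σ.symm) ∘ σ = w := fun w => by ext; simp
  refine ⟨x ∘ σ.symm, y ∘ σ.symm, fun i => hxy _, fun g hg hne => ?_, ?_⟩
  · obtain ⟨ρ, s, rfl⟩ := mem_B2Ineqs.1 hg
    obtain ⟨π, rfl⟩ : ∃ π : Equiv.Perm (Fin 3), π.trans σ = ρ :=
      ⟨ρ.trans σ.symm, by ext; simp⟩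
    simp only [Equiv.trans_apply] at hne ⊢
    rw [b2Functional_perm, hcomp, hcomp]
    refine (hle s (π 0) (π 1) (π 2) (by simp) (by simp) (by simp)).resolve_right fun h => hne ?_
    funext p
    rw [b2Functional_perm, h, b2Functional_perm]
  · rwa [b2Functional_perm, hcomp, hcomp]

end Irredundancy

/-- The `Δ`-side length polyhedron for triangles with root system `B₂ = C₂`,
realized by `5×5` real skew-symmetric matrices: for `(x, y)` in the chamber,
the spectral data is realizable iff all the stability inequalities hold;
moreover, this system of inequalities is irredundant. -/
theorem b2_triangle_side_lengths :
    (∀ x y : Fin 3 → ℝ, B2Chamber x y →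
      (SkewB2Realization x y ↔ ∀ f ∈ B2Ineqs, f (x, y) ≤ 0)) ∧
    (∀ f ∈ B2Ineqs, ∃ x y : Fin 3 → ℝ, B2Chamber x y ∧
      (∀ g ∈ B2Ineqs, g ≠ f → g (x, y) ≤ 0) ∧ 0 < f (x, y)) :=
  ⟨fun _ _ hxy => ⟨fun h => forall_mem_B2Ineqs.2 (h.forall_le hxy), fun h =>
    skewB2Realization_of_forall_le hxy (forall_mem_B2Ineqs.1 h)⟩, fun _ => B2Ineqs_irredundant⟩
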